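/- Suppose the pair predictor p̂₂ is pair-calibrated with grouping function Φ, and let (Ω, P), X, Ỹ, A be as in the conditional-independence setup. Then E[(p̂₁(Ỹ|X) − p(Ỹ|X))² | A] = E[V̂(Ỹ|X) | A], where the conditional expectations are with respect to P given the event A. -/

import Mathlib

open Finset

open scoped Classical

/-- Conditional expectation of `f(X)` given `X ∈ [x]_Φ`, where `X ∼ μ` on a finite set. -/
noncomputable def groupExp {𝒳 𝒵 : Type*} [Fintype 𝒳] (μ : 𝒳 → ℝ) (Φ : 𝒳 → 𝒵)
    (f : 𝒳 → ℝ) (x : 𝒳) : ℝ :=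
  (∑ x' : 𝒳, if Φ x' = Φ x then μ x' * f x' else 0) /
  (∑ x' : 𝒳, if Φ x' = Φ x then μ x' else 0)

/-- Marginal `p̂₁(y|x) = ∑_{y'} p̂₂(y,y'|x)` of a pair predictor. -/
noncomputable def marginal {𝒳 𝒴 : Type*} [Fintype 𝒴] (p2 : 𝒳 → 𝒴 → 𝒴 → ℝ) (x : 𝒳) (y : 𝒴) : ℝ :=
  ∑ y' : 𝒴, p2 x y y'

/-- Cheat-corrected epistemic variance `V̂(y|x) = p̂₂(y,y|x) − p̂₁(y|x)²`. -/
noncomputable def cheatVar {𝒳 𝒴 : Type*} [Fintype 𝒴] (p2 : 𝒳 → 𝒴 → 𝒴 → ℝ) (x : 𝒳) (y : 𝒴) : ℝ :=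
  p2 x y y - (marginal p2 x y) ^ 2

/-- Cheat-corrected epistemic confidence `C(y|x)`. -/
noncomputable def cheatConf {𝒳 𝒴 : Type*} [Fintype 𝒴] (p2 : 𝒳 → 𝒴 → 𝒴 → ℝ) (x : 𝒳) (y : 𝒴) : ℝ :=
  if 0 < p2 x y y then (marginal p2 x y) ^ 2 / p2 x y y else 0


/-- The tower property: averaging over groups preserves expectations weighted by a function that is
constant on groups. -/
theorem sum_mul_groupExp {𝒳 𝒵 : Type*} [Fintype 𝒳] {μ : 𝒳 → ℝ} (hμ : ∀ x, 0 < μ x)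
    {Φ : 𝒳 → 𝒵} {g : 𝒳 → ℝ} (hg : ∀ x x', Φ x = Φ x' → g x = g x') (f : 𝒳 → ℝ) :
    ∑ x, μ x * g x * groupExp μ Φ f x = ∑ x, μ x * g x * f x := by
  set S : 𝒳 → ℝ := fun x => ∑ x', if Φ x' = Φ x then μ x' else 0 with hS
  have hS_pos (x : 𝒳) : 0 < S x :=
    Finset.sum_pos' (fun x' _ => by split_ifs; exacts [(hμ x').le, le_rfl])
      ⟨x, Finset.mem_univ x, by simpa using hμ x⟩
  have hS_congr {x x' : 𝒳} (h : Φ x = Φ x') : S x = S x' := by simp only [hS, h]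
  calc ∑ x, μ x * g x * groupExp μ Φ f x
      = ∑ x, ∑ x', (if Φ x = Φ x' then μ x else 0) * (μ x' * g x' * f x' / S x') := by
        refine Finset.sum_congr rfl fun x _ => ?_
        rw [groupExp, ← mul_div_assoc, Finset.mul_sum, Finset.sum_div]
        refine Finset.sum_congr rfl fun x' _ => ?_
        by_cases h : Φ x' = Φ x
        · rw [if_pos h, if_pos h.symm, ← hg x' x h, hS_congr h]
          ring
        · rw [if_neg h, if_neg (Ne.symm h)]
          simp
    _ = ∑ x', S x' * (μ x' * g x' * f x' / S x') := by
        rw [Finset.sum_comm]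
        simp only [hS, Finset.sum_mul]
    _ = ∑ x, μ x * g x * f x :=
        Finset.sum_congr rfl fun x _ => mul_div_cancel₀ _ (hS_pos x).ne'

theorem groupExp_congr {𝒳 𝒵 : Type*} [Fintype 𝒳] (μ : 𝒳 → ℝ) {Φ : 𝒳 → 𝒵} (f : 𝒳 → ℝ) {x x' : 𝒳}
    (h : Φ x = Φ x') : groupExp μ Φ f x = groupExp μ Φ f x' := by
  simp only [groupExp, h]

theorem groupExp_sum {𝒳 𝒵 ι : Type*} [Fintype 𝒳] [Fintype ι] (μ : 𝒳 → ℝ) (Φ : 𝒳 → 𝒵)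
    (f : ι → 𝒳 → ℝ) (x : 𝒳) :
    ∑ i, groupExp μ Φ (f i) x = groupExp μ Φ (fun x' => ∑ i, f i x') x := by
  simp only [groupExp, ← Finset.sum_div]
  rw [Finset.sum_comm]
  congr 1
  refine Finset.sum_congr rfl fun x' _ => ?_
  split_ifs <;> simp [Finset.mul_sum]

/-- The marginal of a pair-calibrated predictor is calibrated. -/
theorem marginal_eq_groupExp {𝒳 𝒴 𝒵 : Type*} [Fintype 𝒳] [Fintype 𝒴] {μ : 𝒳 → ℝ}
    {p : 𝒳 → 𝒴 → ℝ} (hp : ∀ x, ∑ y, p x y = 1) {p2 : 𝒳 → 𝒴 → 𝒴 → ℝ} {Φ : 𝒳 → 𝒵}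
    (hcal : ∀ x y₁ y₂, p2 x y₁ y₂ = groupExp μ Φ (fun x' => p x' y₁ * p x' y₂) x)
    (x : 𝒳) (y : 𝒴) : marginal p2 x y = groupExp μ Φ (fun x' => p x' y) x := by
  simp only [marginal, hcal, groupExp_sum, ← Finset.mul_sum, hp, mul_one]

/-- The integral of a function of two finitely valued random variables over an event. -/
theorem setIntegral_eq_sum_of_finite {𝒳 𝒴 Ω : Type*} [Fintype 𝒳] [Fintype 𝒴] [MeasurableSpace Ω]
    (P : MeasureTheory.Measure Ω) [MeasureTheory.IsFiniteMeasure P]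
    {X : Ω → 𝒳} {Y : Ω → 𝒴} (A : Set Ω)
    (hX : ∀ x, MeasurableSet {ω | X ω = x}) (hY : ∀ y, MeasurableSet {ω | Y ω = y})
    (f : 𝒳 → 𝒴 → ℝ) :
    ∫ ω in A, f (X ω) (Y ω) ∂P
      = ∑ y, ∑ x, P.real ({ω | Y ω = y} ∩ A ∩ {ω | X ω = x}) * f x y := by
  have hYX (x : 𝒳) (y : 𝒴) : MeasurableSet ({ω | Y ω = y} ∩ {ω | X ω = x}) := (hY y).inter (hX x)
  have hf (ω : Ω) : f (X ω) (Y ω) =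
      ∑ y, ∑ x, ({ω | Y ω = y} ∩ {ω | X ω = x}).indicator (fun _ => f x y) ω := by
    simp [Set.indicator_apply, ite_and]
  have hint (x : 𝒳) (y : 𝒴) : MeasureTheory.Integrable
      (({ω | Y ω = y} ∩ {ω | X ω = x}).indicator fun _ => f x y) (P.restrict A) :=
    (MeasureTheory.integrable_const _).indicator (hYX x y)
  simp only [hf]
  rw [MeasureTheory.integral_finsetSum _ fun y _ =>
    MeasureTheory.integrable_finsetSum _ fun x _ => hint x y]
  refine Finset.sum_congr rfl fun y _ => ?_
  rw [MeasureTheory.integral_finsetSum _ fun x _ => hint x y]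
  refine Finset.sum_congr rfl fun x _ => ?_
  rw [MeasureTheory.integral_indicator_const _ (hYX x y),
    MeasureTheory.measureReal_restrict_apply (hYX x y), smul_eq_mul, Set.inter_right_comm]

/-- For a pair-calibrated pair predictor and a decoding setup where
`(Ỹ, A)` is conditionally independent of `X` given `Φ(X)`, the conditional expected
squared error given `A` equals the conditional expectation of the cheat-corrected
epistemic variance given `A`. -/
theorem stmt_6 {𝒳 𝒴 𝒵 : Type*} [Fintype 𝒳] [Fintype 𝒴] [Nonempty 𝒳] [Nonempty 𝒴]
    (μ : 𝒳 → ℝ) (hμpos : ∀ x, 0 < μ x) (hμsum : ∑ x, μ x = 1)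
    (p : 𝒳 → 𝒴 → ℝ) (hp0 : ∀ x y, 0 ≤ p x y) (hp1 : ∀ x, ∑ y, p x y = 1)
    (p2 : 𝒳 → 𝒴 → 𝒴 → ℝ)
    (hp20 : ∀ x y₁ y₂, 0 ≤ p2 x y₁ y₂) (hp21 : ∀ x, ∑ y₁, ∑ y₂, p2 x y₁ y₂ = 1)
    (Φ : 𝒳 → 𝒵)
    (hcal : ∀ x y₁ y₂, p2 x y₁ y₂ = groupExp μ Φ (fun x' => p x' y₁ * p x' y₂) x)
    {Ω : Type*} [MeasurableSpace Ω] (P : MeasureTheory.Measure Ω)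
    [MeasureTheory.IsProbabilityMeasure P]
    (X : Ω → 𝒳) (Yt : Ω → 𝒴) (A : Set Ω)
    (hA : MeasurableSet A) (hXm : ∀ x, MeasurableSet {ω | X ω = x})
    (hYm : ∀ y, MeasurableSet {ω | Yt ω = y})
    (hPA : 0 < P A)
    (hdist : ∀ x, P {ω | X ω = x} = ENNReal.ofReal (μ x))
    (hCI : ∀ (x : 𝒳) (y : 𝒴),
      P ({ω | Yt ω = y} ∩ A ∩ {ω | X ω = x}) * P {ω | Φ (X ω) = Φ x}
        = P ({ω | Yt ω = y} ∩ A ∩ {ω | Φ (X ω) = Φ x}) * P {ω | X ω = x}) :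
    (∫ ω in A, (marginal p2 (X ω) (Yt ω) - p (X ω) (Yt ω)) ^ 2 ∂P) / (P A).toReal
      = (∫ ω in A, cheatVar p2 (X ω) (Yt ω) ∂P) / (P A).toReal := by
  set k : 𝒴 → 𝒳 → ℝ := fun y x =>
    P.real ({ω | Yt ω = y} ∩ A ∩ {ω | Φ (X ω) = Φ x}) / P.real {ω | Φ (X ω) = Φ x} with hk
  have hk_congr (y : 𝒴) (x x' : 𝒳) (h : Φ x = Φ x') : k y x = k y x' := by simp only [hk, h]
  have hX_real (x : 𝒳) : P.real {ω | X ω = x} = μ x := by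
    rw [MeasureTheory.measureReal_def, hdist, ENNReal.toReal_ofReal (hμpos x).le]
  have hjoint (x : 𝒳) (y : 𝒴) :
      P.real ({ω | Yt ω = y} ∩ A ∩ {ω | X ω = x}) = μ x * k y x := by
    have hpos : 0 < P.real {ω | Φ (X ω) = Φ x} :=
      (hX_real x ▸ hμpos x).trans_le
        (MeasureTheory.measureReal_mono fun ω (hω : X ω = x) => congrArg Φ hω)
    have h := congrArg ENNReal.toReal (hCI x y)
    simp only [ENNReal.toReal_mul, ← MeasureTheory.measureReal_def, hX_real] at h
    rw [hk, ← mul_div_assoc, eq_div_iff hpos.ne', h, mul_comm]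
  have hm := marginal_eq_groupExp hp1 hcal
  congr 1
  rw [setIntegral_eq_sum_of_finite P A hXm hYm fun x y => (marginal p2 x y - p x y) ^ 2,
    setIntegral_eq_sum_of_finite P A hXm hYm fun x y => cheatVar p2 x y]
  refine Finset.sum_congr rfl fun y _ => ?_
  have hfirst := sum_mul_groupExp hμpos (Φ := Φ) (g := fun x => k y x * marginal p2 x y)
    (fun x x' h => by simp only [hm, hk_congr y x x' h, groupExp_congr μ _ h]) fun x => p x y
  have hsecond := sum_mul_groupExp hμpos (hk_congr y) fun x => p x y * p x y
  simp only [← hm] at hfirst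
  simp only [← hcal] at hsecond
  simp only [hjoint, cheatVar]
  rw [← sub_eq_zero] at hfirst hsecond ⊢
  rw [← Finset.sum_sub_distrib] at hfirst hsecond ⊢
  calc _ = 2 * ∑ x, (μ x * (k y x * marginal p2 x y) * marginal p2 x y
            - μ x * (k y x * marginal p2 x y) * p x y)
          - ∑ x, (μ x * k y x * p2 x y y - μ x * k y x * (p x y * p x y)) := by
        rw [Finset.mul_sum, ← Finset.sum_sub_distrib]
        exact Finset.sum_congr rfl fun x _ => by ring
    _ = 0 := by rw [hfirst, hsecond]; ring
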